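/- Given combinatorial Heegaard diagram data with cyclic orders and the induced arc pairings and functions ℓ and ℓ̃ as in the context, let G : C × C → ℚ satisfy the cycle conditions: for every d ∈ C and every i₀ ∈ Fin g, Σ_{c : ι(c)=i₀} G(c,d) = 0, and for every c ∈ C and every j₀ ∈ Fin g, Σ_{d : κ(d)=j₀} G(c,d) = 0. Then Σ_{(c,d) ∈ C × C} G(c,d) · ℓ(c,d) = Σ_{(c,d) ∈ C × C} G(c,d) · ℓ̃(c,d). (This is the equality of the ℓ-sum and the ℓ̃-sum for 2-cycles asserted in the paper's Proposition on ℓ⁽²⁾.) -/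

import Mathlib

open scoped BigOperators

/-- Weight function of the half-open arc `[p,c|` on a cyclically ordered finite set
(the cyclic order being given by a bijection `e` with `ZMod (card S)`): when `p ≠ c`,
it assigns weight `1` to `p` and to every point strictly between `p` and `c` (travelling
from `p` in the positive cyclic direction), weight `1/2` to `c`, and `0` elsewhere;
when `p = c` it assigns weight `1/2` to `p` and `0` elsewhere. -/
def arcWeightHO {S : Type*} [Fintype S] [DecidableEq S]
    (e : S ≃ ZMod (Fintype.card S)) (p c x : S) : ℚ :=
  if p = c then (if x = p then 1 / 2 else 0)
  else if x = p then 1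
  else if x = c then 1 / 2
  else if 0 < (e x - e p).val ∧ (e x - e p).val < (e c - e p).val then 1
  else 0

/-- Weight function of the arc `|p,c|` on a cyclically ordered finite set: when `p ≠ c`,
it assigns weight `1/2` to `p` and to `c`, weight `1` to every point strictly between
`p` and `c` (travelling from `p` in the positive cyclic direction), and `0` elsewhere;
`|p,p|` is identically `0`. -/
def arcWeightOO {S : Type*} [Fintype S] [DecidableEq S]
    (e : S ≃ ZMod (Fintype.card S)) (p c x : S) : ℚ :=
  if p = c then 0
  else if x = p then 1 / 2
  else if x = c then 1 / 2
  else if 0 < (e x - e p).val ∧ (e x - e p).val < (e c - e p).val then 1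
  else 0

/-- The function `ℓ(c,d)` of the paper, defined from combinatorial Heegaard diagram data
with cyclic orders, a matrix `J`, and basepoints `p(i)` on the α-curves and `q(j)` on the
β-curves, using the half-open arcs `[·,·|`:
`ℓ(c,d) = ⟨[p(ι c),c|_α, [q(κ d),d|_β⟩ − Σ_{i,j} J_{j,i}·⟨[p(ι c),c|_α, β_j⟩·⟨α_i, [q(κ d),d|_β⟩`. -/
noncomputable def ellFun {C : Type*} [Fintype C] [DecidableEq C] {g : ℕ}
    (ι κ : C → Fin g) (σ : C → ℚ) (J : Matrix (Fin g) (Fin g) ℚ)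
    (eA : ∀ i : Fin g, {c : C // ι c = i} ≃ ZMod (Fintype.card {c : C // ι c = i}))
    (eB : ∀ j : Fin g, {c : C // κ c = j} ≃ ZMod (Fintype.card {c : C // κ c = j}))
    (p : Fin g → C) (hp : ∀ i, ι (p i) = i)
    (q : Fin g → C) (hq : ∀ j, κ (q j) = j)
    (c d : C) : ℚ :=
  let wA : C → ℚ := fun x =>
    if hx : ι x = ι c then
      arcWeightHO (eA (ι c)) ⟨p (ι c), hp (ι c)⟩ ⟨c, rfl⟩ ⟨x, hx⟩
    else 0
  let wB : C → ℚ := fun x =>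
    if hx : κ x = κ d then
      arcWeightHO (eB (κ d)) ⟨q (κ d), hq (κ d)⟩ ⟨d, rfl⟩ ⟨x, hx⟩
    else 0
  (∑ x : C, wA x * wB x * σ x) -
    ∑ i : Fin g, ∑ j : Fin g, J j i *
      (∑ x ∈ Finset.univ.filter (fun x => κ x = j), wA x * σ x) *
      (∑ x ∈ Finset.univ.filter (fun x => ι x = i), wB x * σ x)

/-- The function `ℓ̃(c,d)` of the paper: the same expression as `ℓ(c,d)` with the
half-open arcs `[·,·|` replaced by the arcs `|·,·|`. -/
noncomputable def ellTildeFun {C : Type*} [Fintype C] [DecidableEq C] {g : ℕ}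
    (ι κ : C → Fin g) (σ : C → ℚ) (J : Matrix (Fin g) (Fin g) ℚ)
    (eA : ∀ i : Fin g, {c : C // ι c = i} ≃ ZMod (Fintype.card {c : C // ι c = i}))
    (eB : ∀ j : Fin g, {c : C // κ c = j} ≃ ZMod (Fintype.card {c : C // κ c = j}))
    (p : Fin g → C) (hp : ∀ i, ι (p i) = i)
    (q : Fin g → C) (hq : ∀ j, κ (q j) = j)
    (c d : C) : ℚ :=
  let wA : C → ℚ := fun x =>
    if hx : ι x = ι c then
      arcWeightOO (eA (ι c)) ⟨p (ι c), hp (ι c)⟩ ⟨c, rfl⟩ ⟨x, hx⟩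
    else 0
  let wB : C → ℚ := fun x =>
    if hx : κ x = κ d then
      arcWeightOO (eB (κ d)) ⟨q (κ d), hq (κ d)⟩ ⟨d, rfl⟩ ⟨x, hx⟩
    else 0
  (∑ x : C, wA x * wB x * σ x) -
    ∑ i : Fin g, ∑ j : Fin g, J j i *
      (∑ x ∈ Finset.univ.filter (fun x => κ x = j), wA x * σ x) *
      (∑ x ∈ Finset.univ.filter (fun x => ι x = i), wB x * σ x)

theorem arcWeightHO_eq {S : Type*} [Fintype S] [DecidableEq S]
    (e : S ≃ ZMod (Fintype.card S)) (p c x : S) :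
    arcWeightHO e p c x = arcWeightOO e p c x + if x = p then 1 / 2 else 0 := by
  unfold arcWeightHO arcWeightOO
  split_ifs <;> norm_num

/-- The bilinear pairing `⟨u, v⟩ − Σ_{i,j} J_{j,i}·⟨u, β_j⟩·⟨α_i, v⟩` of weight functions. -/
def weightPairing {C : Type*} [Fintype C] {g : ℕ}
    (ι κ : C → Fin g) (σ : C → ℚ) (J : Matrix (Fin g) (Fin g) ℚ) (u v : C → ℚ) : ℚ :=
  (∑ x : C, u x * v x * σ x) -
    ∑ i : Fin g, ∑ j : Fin g, J j i *
      (∑ x ∈ Finset.univ.filter (fun x => κ x = j), u x * σ x) *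
      (∑ x ∈ Finset.univ.filter (fun x => ι x = i), v x * σ x)

section weightPairing

variable {C : Type*} [Fintype C] {g : ℕ}
  (ι κ : C → Fin g) (σ : C → ℚ) (J : Matrix (Fin g) (Fin g) ℚ)

theorem weightPairing_add_left (u u' v : C → ℚ) :
    weightPairing ι κ σ J (u + u') v
      = weightPairing ι κ σ J u v + weightPairing ι κ σ J u' v := by
  simp only [weightPairing, Pi.add_apply, add_mul, mul_add, Finset.sum_add_distrib]
  ring

theorem weightPairing_add_right (u v v' : C → ℚ) :
    weightPairing ι κ σ J u (v + v')
      = weightPairing ι κ σ J u v + weightPairing ι κ σ J u v' := by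
  simp only [weightPairing, Pi.add_apply, add_mul, mul_add, Finset.sum_add_distrib]
  ring

end weightPairing

/-- Extended by zero from a fibre of `f`, the weights of `[p,c|` and `|p,c|` differ by half the
indicator of the basepoint, so the difference depends on `c` only through `f c`. -/
theorem dite_arcWeightHO_eq {C : Type*} [Fintype C] [DecidableEq C] {g : ℕ} (f : C → Fin g)
    (e : ∀ i : Fin g, {c : C // f c = i} ≃ ZMod (Fintype.card {c : C // f c = i}))
    (p : Fin g → C) (hp : ∀ i, f (p i) = i) (c : C) :
    (fun x => if hx : f x = f c then
        arcWeightHO (e (f c)) ⟨p (f c), hp (f c)⟩ ⟨c, rfl⟩ ⟨x, hx⟩ else 0)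
      = (fun x => if hx : f x = f c then
          arcWeightOO (e (f c)) ⟨p (f c), hp (f c)⟩ ⟨c, rfl⟩ ⟨x, hx⟩ else 0)
        + Pi.single (p (f c)) (1 / 2 : ℚ) := by
  funext x
  by_cases hx : f x = f c
  · simp [hx, arcWeightHO_eq, Pi.single_apply]
  · have hne : x ≠ p (f c) := fun h => hx (h ▸ hp (f c))
    simp [hx, hne]

/-- A function vanishing in sum over every fibre of `f` is orthogonal to functions that factor
through `f`. -/
theorem sum_mul_comp_eq_zero {C I R : Type*} [Fintype C] [Fintype I] [DecidableEq I]
    [NonUnitalNonAssocSemiring R] (f : C → I) (G : C → R)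
    (hG : ∀ i, ∑ c ∈ Finset.univ.filter (fun c => f c = i), G c = 0) (F : I → R) :
    ∑ c, G c * F (f c) = 0 := by
  rw [← Finset.sum_fiberwise Finset.univ f]
  refine Finset.sum_eq_zero fun i _ => ?_
  calc ∑ c ∈ Finset.univ.filter (fun c => f c = i), G c * F (f c)
      = ∑ c ∈ Finset.univ.filter (fun c => f c = i), G c * F i :=
        Finset.sum_congr rfl fun c hc => by rw [(Finset.mem_filter.mp hc).2]
    _ = 0 := by rw [← Finset.sum_mul, hG, zero_mul]

/-- If `G` satisfies the two cycle conditions (its sums over each α-curve in the first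
variable and over each β-curve in the second variable vanish), then
`Σ_{(c,d)} G(c,d)·ℓ(c,d) = Σ_{(c,d)} G(c,d)·ℓ̃(c,d)`. -/
theorem ell_two_eq_ellTilde_two {C : Type*} [Fintype C] [DecidableEq C]
    (g : ℕ) (hg : 1 ≤ g) (ι κ : C → Fin g) (σ : C → ℚ)
    (J : Matrix (Fin g) (Fin g) ℚ)
    (hJ : ∀ j k : Fin g,
      (∑ i : Fin g, J j i *
        ∑ c ∈ Finset.univ.filter (fun c => ι c = i ∧ κ c = k), σ c)
        = if j = k then 1 else 0)
    (eA : ∀ i : Fin g, {c : C // ι c = i} ≃ ZMod (Fintype.card {c : C // ι c = i}))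
    (eB : ∀ j : Fin g, {c : C // κ c = j} ≃ ZMod (Fintype.card {c : C // κ c = j}))
    (G : C × C → ℚ)
    (hG1 : ∀ d : C, ∀ i₀ : Fin g,
      (∑ c ∈ Finset.univ.filter (fun c => ι c = i₀), G (c, d)) = 0)
    (hG2 : ∀ c : C, ∀ j₀ : Fin g,
      (∑ d ∈ Finset.univ.filter (fun d => κ d = j₀), G (c, d)) = 0)
    (p : Fin g → C) (hp : ∀ i, ι (p i) = i)
    (q : Fin g → C) (hq : ∀ j, κ (q j) = j) :
    ∑ cd : C × C, G cd * ellFun ι κ σ J eA eB p hp q hq cd.1 cd.2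
      = ∑ cd : C × C, G cd * ellTildeFun ι κ σ J eA eB p hp q hq cd.1 cd.2 := by
  let wA : C → C → ℚ := fun c x => if hx : ι x = ι c then
    arcWeightOO (eA (ι c)) ⟨p (ι c), hp (ι c)⟩ ⟨c, rfl⟩ ⟨x, hx⟩ else 0
  let wB : C → C → ℚ := fun d x => if hx : κ x = κ d then
    arcWeightOO (eB (κ d)) ⟨q (κ d), hq (κ d)⟩ ⟨d, rfl⟩ ⟨x, hx⟩ else 0
  let a : Fin g → C → ℚ := fun i => Pi.single (p i) (1 / 2)
  let b : Fin g → C → ℚ := fun j => Pi.single (q j) (1 / 2)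
  let P := weightPairing ι κ σ J
  have h_ell : ∀ c d, ellFun ι κ σ J eA eB p hp q hq c d
      = ellTildeFun ι κ σ J eA eB p hp q hq c d
        + (P (wA c) (b (κ d)) + P (a (ι c)) (wB d + b (κ d))) := by
    intro c d
    have h : ellFun ι κ σ J eA eB p hp q hq c d
        = P (wA c + a (ι c)) (wB d + b (κ d)) := by
      change weightPairing ι κ σ J _ _ = weightPairing ι κ σ J _ _
      congr 1
      · exact dite_arcWeightHO_eq ι eA p hp c
      · exact dite_arcWeightHO_eq κ eB q hq d
    have h_tilde : ellTildeFun ι κ σ J eA eB p hp q hq c d = P (wA c) (wB d) := rfl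
    rw [h, h_tilde]
    simp only [P, weightPairing_add_left, weightPairing_add_right]
    ring
  have h_right : ∑ cd : C × C, G cd * P (wA cd.1) (b (κ cd.2)) = 0 := by
    rw [Fintype.sum_prod_type]
    exact Finset.sum_eq_zero fun c _ =>
      sum_mul_comp_eq_zero κ (fun d => G (c, d)) (hG2 c) fun j => P (wA c) (b j)
  have h_left : ∑ cd : C × C, G cd * P (a (ι cd.1)) (wB cd.2 + b (κ cd.2)) = 0 := by
    rw [Fintype.sum_prod_type_right]
    exact Finset.sum_eq_zero fun d _ =>
      sum_mul_comp_eq_zero ι (fun c => G (c, d)) (hG1 d) fun i => P (a i) (wB d + b (κ d))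
  simp only [h_ell, mul_add, Finset.sum_add_distrib, h_right, h_left, add_zero]
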